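/- Let F be a free group with free basis containing c, and let N be the normal closure of c^{2^n} in F. Let a, b ∈ F and suppose the sum of the absolute values of all exponents of c occurring in the reduced words of a and b is strictly less than 2^{n−1}. If a and g b g^{−1} are congruent modulo N for some g ∈ F (i.e., their images in F/N are equal), and a ≠ g b g^{−1} in F, then a contradiction follows; equivalently: if the images of a and b in F/N are conjugate, then a and b are already conjugate in F. -/

import Mathlib

/-- The sum of the absolute values of the exponents of the letter `c` occurring in the
reduced word of an element of the free group: since in a reduced word every maximal run
of `c`-letters has constant sign, this is the number of letters (with either sign)
equal to `c` in the reduced word. -/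
def cExpSum {S : Type*} [DecidableEq S] (c : S) (a : FreeGroup S) : ℕ :=
  ((a.toWord).filter fun p => p.1 == c).length

namespace FreeGroup

open List

variable {S : Type*}

/-- The free product of one cyclic group for each letter: of order `m` for the letter `c`, and
infinite for the other letters. -/
abbrev CyclicFactor [DecidableEq S] (c : S) (m : ℕ) (s : S) : Type :=
  Multiplicative (ZMod (if s = c then m else 0))

/-- The element of the cyclic factor given by a letter or its inverse. -/
def cyclicLetter [DecidableEq S] (c : S) (m : ℕ) (p : S × Bool) : CyclicFactor c m p.1 :=
  Multiplicative.ofAdd (if p.2 then 1 else -1)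

/-- The projection of the free group killing the `m`-th power of the letter `c`. -/
def toCyclicCoprod [DecidableEq S] (c : S) (m : ℕ) :
    FreeGroup S →* Monoid.CoprodI (CyclicFactor c m) :=
  lift fun s => Monoid.CoprodI.of (cyclicLetter c m (s, true))

theorem toCyclicCoprod_mk_singleton [DecidableEq S] (c : S) (m : ℕ) (p : S × Bool) :
    toCyclicCoprod c m (mk [p]) = Monoid.CoprodI.of (cyclicLetter c m p) := by
  obtain ⟨s, _ | _⟩ := p
  · simp [toCyclicCoprod, cyclicLetter, ofAdd_neg]
  · simp [toCyclicCoprod]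

theorem cyclicLetter_pow_eq_one_iff [DecidableEq S] (c : S) (m k : ℕ) (p : S × Bool) :
    cyclicLetter c m p ^ k = 1 ↔ (if p.1 = c then m else 0) ∣ k := by
  rw [cyclicLetter, ← ofAdd_nsmul, ofAdd_eq_one, ← ZMod.natCast_eq_zero_iff]
  split <;> simp

theorem toCyclicCoprod_of_pow [DecidableEq S] (c : S) (m : ℕ) :
    toCyclicCoprod c m (of c ^ m) = 1 := by
  have h := (cyclicLetter_pow_eq_one_iff c m m (c, true)).2 (by simp)
  rw [_root_.map_pow, of, toCyclicCoprod_mk_singleton, ← _root_.map_pow, h, _root_.map_one]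

theorem cyclicLetter_pow_ne_one [DecidableEq S] {c : S} {m k : ℕ} {p : S × Bool}
    {L : List (S × Bool)} (hL : ∀ d, ¬ replicate m (c, d) <:+: L) (hk : k ≠ 0)
    (hp : replicate k p <+: L) : cyclicLetter c m p ^ k ≠ 1 := by
  rw [Ne, cyclicLetter_pow_eq_one_iff]
  split_ifs with h
  · intro hm
    obtain ⟨s, e⟩ := p
    obtain rfl : s = c := h
    exact hL e <| (prefix_replicate_iff.2 ⟨by simpa using Nat.le_of_dvd (by lia) hm, by simp⟩
      |>.trans hp).isInfix
  · simpa using hk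

theorem exists_toCyclicCoprod_mk_cons [DecidableEq S] {c : S} {m : ℕ} (p : S × Bool)
    (L : List (S × Bool)) (hr : IsReduced (p :: L))
    (hL : ∀ d, ¬ replicate m (c, d) <:+: p :: L) :
      ∃ (k : ℕ) (W : Monoid.CoprodI.Word (CyclicFactor c m)), k ≠ 0 ∧
        W.fstIdx ≠ some p.1 ∧ replicate k p <+: p :: L ∧
        toCyclicCoprod c m (mk (p :: L)) =
          Monoid.CoprodI.of (cyclicLetter c m p ^ k) * W.prod := by
  induction L generalizing p with
  | nil =>
    exact ⟨1, .empty, one_ne_zero, by simp [Monoid.CoprodI.Word.fstIdx], by simp,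
      by simp [toCyclicCoprod_mk_singleton]⟩
  | cons q L ih =>
    have hL' : ∀ d, ¬ replicate m (c, d) <:+: q :: L := fun d h =>
      hL d (h.trans (suffix_cons p _).isInfix)
    obtain ⟨hpq, hr'⟩ := isReduced_cons_cons.1 hr
    obtain ⟨k, W, hk, hW, hpre, heq⟩ := ih q hr' hL'
    have hmk : mk (p :: q :: L) = mk [p] * mk (q :: L) := by simp
    rw [hmk, _root_.map_mul, heq, toCyclicCoprod_mk_singleton]
    by_cases h : p.1 = q.1
    · obtain rfl : p = q := Prod.ext h (hpq h)
      refine ⟨k + 1, W, by simp, hW, ?_, ?_⟩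
      · rw [replicate_succ]
        exact (prefix_cons_inj p).2 hpre
      · rw [← mul_assoc, ← _root_.map_mul, ← pow_succ']
    · refine ⟨1, .cons (cyclicLetter c m q ^ k) W hW (cyclicLetter_pow_ne_one hL' hk hpre),
        one_ne_zero, ?_, by simp, by simp⟩
      simpa using Ne.symm h

/-- A nontrivial reduced word in the normal closure of `c ^ m` contains `c ^ m` or `c ^ (-m)`. -/
theorem eq_nil_of_mk_mem_normalClosure [DecidableEq S] {c : S} {m : ℕ} {L : List (S × Bool)}
    (hr : IsReduced L) (hL : ∀ d, ¬ replicate m (c, d) <:+: L)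
    (hmem : mk L ∈ Subgroup.normalClosure {of c ^ m}) : L = [] := by
  cases L with
  | nil => rfl
  | cons p L =>
    obtain ⟨k, W, hk, hW, hpre, heq⟩ := exists_toCyclicCoprod_mk_cons p L hr hL
    have hker : Subgroup.normalClosure {of c ^ m} ≤ (toCyclicCoprod c m).ker :=
      Subgroup.normalClosure_le_normal (by simpa using toCyclicCoprod_of_pow c m)
    have hne := cyclicLetter_pow_ne_one hL hk hpre
    rw [hker hmem, ← Monoid.CoprodI.Word.prod_cons _ _ _ hne hW,
      ← Monoid.CoprodI.Word.prod_empty] at heq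
    simpa using congrArg Monoid.CoprodI.Word.toList
      (Monoid.CoprodI.Word.equiv.symm.injective (a₁ := .empty) (a₂ := .cons _ W hW hne) heq)

/-- The number of occurrences of the letter `c` and its inverse in a word. -/
abbrev letterCount [DecidableEq S] (c : S) (L : List (S × Bool)) : ℕ :=
  L.countP fun p => p.1 == c

theorem le_letterCount_of_replicate_sublist [DecidableEq S] {c : S} {k : ℕ} {d : Bool}
    {L : List (S × Bool)} (h : replicate k (c, d) <+ L) : k ≤ letterCount c L := by
  simpa [countP_replicate] using h.countP_le (p := fun p => p.1 == c)

theorem letterCount_invRev [DecidableEq S] (c : S) (L : List (S × Bool)) :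
    letterCount c (invRev L) = letterCount c L := by
  simp [letterCount, invRev, countP_map, Function.comp_def]

theorem mk_eq_one_of_letterCount_lt [DecidableEq S] {c : S} {m : ℕ} {L : List (S × Bool)}
    (hL : letterCount c L < m) (hmem : mk L ∈ Subgroup.normalClosure {of c ^ m}) : mk L = 1 := by
  have h : reduce L = [] := by
    refine eq_nil_of_mk_mem_normalClosure (c := c) (m := m)
      (isReduced_iff_reduce_eq.2 reduce.idem) (fun d h => ?_) (by rwa [reduce.self])
    have := le_letterCount_of_replicate_sublist (h.sublist.trans reduce.red.sublist)
    lia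
  rw [← reduce.self, h, one_eq_mk]

theorem IsReduced.invRev {L : List (S × Bool)} (h : IsReduced L) :
    IsReduced (FreeGroup.invRev L) := by
  classical
  rw [isReduced_iff_reduce_eq] at h ⊢
  rw [reduce_invRev, h]

theorem isCyclicallyReduced_cons_iff {p : S × Bool} {L : List (S × Bool)} :
    IsCyclicallyReduced (p :: L) ↔ IsReduced (p :: L ++ [p]) := by
  simp only [isCyclicallyReduced_iff, IsReduced, isChain_append, isChain_singleton, true_and,
    head?_cons]

theorem isCyclicallyReduced_concat_iff {p : S × Bool} {L : List (S × Bool)} :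
    IsCyclicallyReduced (L ++ [p]) ↔ IsReduced (p :: L ++ [p]) := by
  rw [isCyclicallyReduced_iff, IsReduced, IsReduced, cons_append, isChain_cons, and_comm]
  simp

theorem snd_eq_not_of_ne {p q : S × Bool} (h : p ≠ q) (h₁ : p.1 = q.1) : (!p.2) = q.2 :=
  Bool.not_eq.2 fun h₂ => h (Prod.ext h₁ h₂)

/-- The word `A⁻¹ G B G⁻¹` is reduced when none of its junctions cancels. -/
theorem isReduced_conj {A B G : List (S × Bool)} (hA : IsReduced A) (hB : IsReduced B)
    (hG : IsReduced G) (hAG : ∀ u ∈ A.head?, ∀ v ∈ G.head?, u ≠ v)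
    (hGB : ∀ u ∈ G.getLast?, ∀ v ∈ B.head?, v ≠ (u.1, !u.2))
    (hlast : ∀ u ∈ G.getLast?, ∀ v ∈ B.getLast?, u ≠ v) (hBne : B ≠ [])
    (hGne : G ≠ []) :
    IsReduced ((FreeGroup.invRev A ++ G) ++ (B ++ FreeGroup.invRev G)) := by
  refine isChain_append.2 ⟨isChain_append.2 ⟨hA.invRev, hG, ?_⟩,
    isChain_append.2 ⟨hB, hG.invRev, ?_⟩, ?_⟩
  · intro u hu v hv h
    obtain ⟨x, hx, rfl⟩ : ∃ x ∈ A.head?, (x.1, !x.2) = u := by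
      simpa [FreeGroup.invRev] using hu
    exact snd_eq_not_of_ne (hAG x hx v hv) h
  · intro u hu v hv h
    obtain ⟨z, hz, rfl⟩ : ∃ z ∈ G.getLast?, (z.1, !z.2) = v := by
      simpa [FreeGroup.invRev] using hv
    exact (snd_eq_not_of_ne (hlast z hz u hu) h.symm).symm
  · intro u hu v hv h
    rw [getLast?_append_of_ne_nil _ hGne] at hu
    rw [head?_append_of_ne_nil _ hBne] at hv
    simpa using (snd_eq_not_of_ne (hGB u hu v hv) h.symm).symm

/-- The word `A⁻¹ G B G⁻¹` has no long run of the letter `c` when `A` and `B` have few `c`s,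
the runs of `c` in `G` are short, and the last letters of `G` and `B` differ. -/
theorem not_replicate_infix_conj [DecidableEq S] {c : S} {m l : ℕ} {A B G : List (S × Bool)}
    (hm : letterCount c A + letterCount c B + l < m)
    (hG : ∀ k d, replicate k (c, d) <:+: G → k ≤ l) (hB : B ≠ [])
    (hlast : ∀ x ∈ G.getLast?, ∀ y ∈ B.getLast?, x ≠ y) (d : Bool) :
    ¬ replicate m (c, d) <:+: (FreeGroup.invRev A ++ G) ++ (B ++ FreeGroup.invRev G) := by
  have hG' : ∀ k d, replicate k (c, d) <:+: FreeGroup.invRev G → k ≤ l := by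
    rintro k d ⟨u, v, h⟩
    refine hG k (!d) ⟨FreeGroup.invRev v, FreeGroup.invRev u, ?_⟩
    rw [← invRev_invRev (L₁ := G), ← h]
    simp [FreeGroup.invRev]
  have hA (k) (d) (h : replicate k (c, d) <+ FreeGroup.invRev A) : k ≤ letterCount c A :=
    (le_letterCount_of_replicate_sublist h).trans_eq (letterCount_invRev c A)
  have hB' (k) (d) (h : replicate k (c, d) <+ B) : k ≤ letterCount c B :=
    le_letterCount_of_replicate_sublist h
  have key₁ (k) (h : replicate k (c, d) <:+: FreeGroup.invRev A ++ G) :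
      k ≤ letterCount c A + l := by
    obtain h | h | ⟨l₁, l₂, -, -, heq, h₁, h₂⟩ := infix_append_iff_ne_nil.1 h
    · have := hA _ _ h.sublist; lia
    · have := hG _ _ h; lia
    · obtain ⟨hl, e₁, e₂⟩ := append_eq_replicate_iff.1 heq.symm
      rw [e₁] at h₁; rw [e₂] at h₂
      have := hA _ _ h₁.sublist
      have := hG _ _ h₂.isInfix
      lia
  have key₂ (k) (h : replicate k (c, d) <:+: B ++ FreeGroup.invRev G) :
      k ≤ letterCount c B + l := by
    obtain h | h | ⟨l₁, l₂, -, -, heq, h₁, h₂⟩ := infix_append_iff_ne_nil.1 h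
    · have := hB' _ _ h.sublist; lia
    · have := hG' _ _ h; lia
    · obtain ⟨hl, e₁, e₂⟩ := append_eq_replicate_iff.1 heq.symm
      rw [e₁] at h₁; rw [e₂] at h₂
      have := hB' _ _ h₁.sublist
      have := hG' _ _ h₂.isInfix
      lia
  intro h
  obtain h | h | ⟨l₁, l₂, hn₁, hn₂, heq, h₁, h₂⟩ := infix_append_iff_ne_nil.1 h
  · have := key₁ _ h; lia
  · have := key₂ _ h; lia
  obtain ⟨hl, e₁, e₂⟩ := append_eq_replicate_iff.1 heq.symm
  have hi : l₁.length ≤ letterCount c A + l := key₁ _ (by rw [← e₁]; exact h₁.isInfix)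
  have hj : letterCount c B < l₂.length := by lia
  have hBpre : B <+: l₂ := by
    refine (prefix_or_prefix_of_prefix (prefix_append B _) h₂).resolve_right fun h => ?_
    have := hB' l₂.length d (e₂ ▸ h.sublist)
    lia
  have hBall : ∀ y ∈ B, y = (c, d) := fun y hy =>
    eq_of_mem_replicate (e₂ ▸ hBpre.subset hy)
  rcases eq_or_ne G [] with rfl | hGne
  · simp at h₂
    have := hB' l₂.length d (e₂ ▸ h₂.sublist)
    lia
  · have hl₁ : l₁.getLast hn₁ = (c, d) :=
      eq_of_mem_replicate (n := l₁.length) (by rw [← e₁]; exact getLast_mem hn₁)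
    have hGl : G.getLast hGne = (c, d) := by
      rw [← hl₁, h₁.getLast hn₁, getLast_append_of_ne_nil _ hGne]
    exact hlast _ (getLast_mem_getLast? hGne) _ (getLast_mem_getLast? hB)
      (hGl.trans (hBall _ (getLast_mem hB)).symm)

theorem mk_cons (p : S × Bool) (L : List (S × Bool)) : mk (p :: L) = mk [p] * mk L := by
  rw [mul_mk, singleton_append]

theorem mk_replicate (k : ℕ) (p : S × Bool) : mk (replicate k p) = mk [p] ^ k := by
  induction k with
  | zero => rfl
  | succ k ih => rw [replicate_succ, pow_succ', ← ih, mk_cons]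

theorem mk_singleton_not (s : S) (d : Bool) : mk [(s, !d)] = (mk [(s, d)])⁻¹ := by
  simp [FreeGroup.invRev]

/-- A run of more than `m / 2` letters `c` can be shortened modulo the normal closure of `c ^ m`. -/
theorem mk'_mk_replicate (c : S) {j m : ℕ} (h : j ≤ m) (d : Bool) :
    QuotientGroup.mk' (Subgroup.normalClosure {of c ^ m}) (mk (replicate j (c, d))) =
      QuotientGroup.mk' (Subgroup.normalClosure {of c ^ m}) (mk (replicate (m - j) (c, !d))) := by
  set π := QuotientGroup.mk' (Subgroup.normalClosure {of c ^ m})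
  have hc : π (of c) ^ m = 1 := by
    rw [← _root_.map_pow]
    exact (QuotientGroup.eq_one_iff _).2 (Subgroup.subset_normalClosure rfl)
  have hd : π (mk [(c, d)]) ^ m = 1 := by
    cases d
    · rw [← Bool.not_true, mk_singleton_not, _root_.map_inv, inv_pow]
      exact inv_eq_one.2 hc
    · exact hc
  rw [mk_replicate, mk_replicate, mk_singleton_not, inv_pow, _root_.map_inv, _root_.map_pow,
    _root_.map_pow, eq_inv_iff_mul_eq_one, ← pow_add, Nat.add_sub_cancel' h, hd]

theorem isConj_mk_cons_concat (p : S × Bool) (L : List (S × Bool)) :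
    IsConj (mk (p :: L)) (mk (L ++ [p])) := by
  rw [← singleton_append, ← mul_mk, ← mul_mk]
  exact isConj_iff.2 ⟨(mk [p])⁻¹, by group⟩

theorem letterCount_concat [DecidableEq S] (c : S) (p : S × Bool) (L : List (S × Bool)) :
    letterCount c (L ++ [p]) = letterCount c (p :: L) :=
  (perm_append_singleton p L).countP_eq _

theorem isConj_mk_of_isCyclicallyReduced [DecidableEq S] {c : S} {m : ℕ}
    {A B G : List (S × Bool)} (hm : letterCount c A + letterCount c B + m / 2 < m)
    (hA : IsCyclicallyReduced A) (hB : IsCyclicallyReduced B)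
    (heq : QuotientGroup.mk' (Subgroup.normalClosure {of c ^ m}) (mk A * mk G) =
      QuotientGroup.mk' (Subgroup.normalClosure {of c ^ m}) (mk G * mk B)) :
    IsConj (mk A) (mk B) := by
  induction hn : G.length using Nat.strong_induction_on generalizing A B G with
  | _ n ih =>
  subst hn
  set π := QuotientGroup.mk' (Subgroup.normalClosure {of c ^ m}) with hπ
  have hmem (x) : x ∈ Subgroup.normalClosure {of c ^ m} ↔ π x = 1 :=
    (QuotientGroup.eq_one_iff x).symm
  by_cases hGr : IsReduced G
  swap
  · refine ih _ ?_ hm hA hB (G := reduce G) (by rwa [reduce.self]) rfl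
    have hsub := (reduce.red (L := G)).sublist
    exact lt_of_le_of_ne hsub.length_le fun h =>
      hGr (isReduced_iff_reduce_eq.2 (hsub.eq_of_length h))
  by_cases hrun : ∃ d, replicate (m / 2 + 1) (c, d) <:+: G
  · obtain ⟨d, u, v, rfl⟩ := hrun
    refine ih _ ?_ hm hA hB (G := u ++ replicate (m - (m / 2 + 1)) (c, !d) ++ v) ?_ rfl
    · simp only [length_append, length_replicate]
      lia
    · simp only [← mul_mk, _root_.map_mul] at heq ⊢
      rwa [hπ, ← mk'_mk_replicate c (by lia), ← hπ]
  have hG : ∀ k d, replicate k (c, d) <:+: G → k ≤ m / 2 := by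
    intro k d h
    by_contra! hk
    exact hrun ⟨d, (prefix_replicate_iff.2 ⟨by simpa using hk, by simp⟩).isInfix.trans h⟩
  cases G using List.reverseRecOn with
  | nil =>
    have h : (mk A)⁻¹ * mk B = 1 := by
      rw [inv_mk, mul_mk]
      refine mk_eq_one_of_letterCount_lt (c := c) (m := m) ?_ ?_
      · rw [letterCount, countP_append, ← letterCount, letterCount_invRev]
        lia
      · rw [← mul_mk, ← inv_mk, hmem, _root_.map_mul, _root_.map_inv, inv_mul_eq_one]
        simpa [← one_eq_mk] using heq
    rw [inv_mul_eq_one.1 h]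
  | append_singleton G z =>
  have hz : mk (G ++ [z]) = mk G * mk [z] := mul_mk.symm
  by_cases hBz : ∃ t, B = t ++ [z]
  · obtain ⟨t, rfl⟩ := hBz
    refine (ih G.length (by simp) (B := z :: t) (by rwa [← letterCount_concat]) hA
      (isCyclicallyReduced_cons_iff.2 (isCyclicallyReduced_concat_iff.1 hB)) ?_ rfl).trans
      (isConj_mk_cons_concat z t)
    rw [← mul_mk, ← mul_mk] at heq
    rw [mk_cons]
    simp only [_root_.map_mul, ← mul_assoc] at heq ⊢
    exact mul_right_cancel heq
  by_cases hBz' : ∃ t, B = (z.1, !z.2) :: t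
  · obtain ⟨t, rfl⟩ := hBz'
    refine (ih G.length (by simp) (B := t ++ [(z.1, !z.2)]) (by rwa [letterCount_concat]) hA
      (isCyclicallyReduced_concat_iff.2 (isCyclicallyReduced_cons_iff.1 hB)) ?_ rfl).trans
      (isConj_mk_cons_concat _ t).symm
    rw [mk_cons, mk_singleton_not, hz, mul_assoc, mul_inv_cancel_left] at heq
    rw [← mul_mk, mk_singleton_not]
    simp only [_root_.map_mul, _root_.map_inv, ← mul_assoc] at heq ⊢
    exact eq_mul_inv_of_mul_eq heq
  by_cases hAx : ∃ x t G', A = x :: t ∧ G ++ [z] = x :: G'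
  · obtain ⟨x, t, G', rfl, hG'⟩ := hAx
    rw [hG'] at heq ih
    refine (isConj_mk_cons_concat x t).trans (ih G'.length (by simp) (A := t ++ [x])
      (by rwa [letterCount_concat])
      (isCyclicallyReduced_concat_iff.2 (isCyclicallyReduced_cons_iff.1 hA)) hB ?_ rfl)
    rw [mk_cons, mk_cons x G'] at heq
    rw [← mul_mk]
    simp only [_root_.map_mul, mul_assoc] at heq ⊢
    exact mul_left_cancel heq
  rcases eq_or_ne A [] with rfl | hAne
  · rw [mk_eq_one_of_letterCount_lt (c := c) (m := m) (L := B) (by lia), one_eq_mk]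
    rw [← one_eq_mk, one_mul, _root_.map_mul] at heq
    exact (hmem _).2 (left_eq_mul.1 heq)
  rcases eq_or_ne B [] with rfl | hBne
  · rw [mk_eq_one_of_letterCount_lt (c := c) (m := m) (L := A) (by lia), one_eq_mk]
    rw [← one_eq_mk, mul_one, _root_.map_mul] at heq
    exact (hmem _).2 (mul_eq_right.1 heq)
  have hne : ∀ u ∈ (G ++ [z]).getLast?, ∀ v ∈ B.getLast?, u ≠ v := by
    rintro u hu v hv rfl
    obtain rfl : z = u := by simpa using hu
    exact hBz (getLast?_eq_some_iff.1 hv)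
  have hred := isReduced_conj hA.isReduced hB.isReduced hGr
    (fun u hu v hv huv => by
      obtain ⟨t, ht⟩ := head?_eq_some_iff.1 hu
      obtain ⟨G', hG'⟩ := head?_eq_some_iff.1 hv
      exact hAx ⟨v, t, G', huv ▸ ht, hG'⟩)
    (fun u hu v hv huv => by
      obtain ⟨t, ht⟩ := head?_eq_some_iff.1 hv
      obtain rfl : z = u := by simpa using hu
      exact hBz' ⟨t, huv ▸ ht⟩)
    hne hBne (by simp)
  have hnil := eq_nil_of_mk_mem_normalClosure (c := c) (m := m) hred
    (not_replicate_infix_conj hm hG hBne hne) ?_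
  · simp at hnil
  · rw [hmem, ← mul_mk, ← mul_mk, ← mul_mk (L₁ := B), ← inv_mk, ← inv_mk]
    rw [_root_.map_mul, _root_.map_mul] at heq
    simp only [_root_.map_mul, _root_.map_inv]
    rw [← mul_assoc, mul_assoc _ (π _) (π (mk B)), ← heq]
    group

theorem exists_isConj_isCyclicallyReduced [DecidableEq S] (c : S) (a : FreeGroup S) :
    ∃ A, IsCyclicallyReduced A ∧ IsConj a (mk A) ∧ letterCount c A ≤ cExpSum c a := by
  have h := reduceCyclically.conj_conjugator_reduceCyclically a.toWord
  refine ⟨reduceCyclically a.toWord, reduceCyclically.isCyclicallyReduced isReduced_toWord, ?_, ?_⟩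
  · refine IsConj.symm (isConj_iff.2 ⟨mk (reduceCyclically.conjugator a.toWord), ?_⟩)
    rw [inv_mk, mul_mk, mul_mk, h, mk_toWord]
  · rw [cExpSum, ← countP_eq_length_filter]
    conv_rhs => rw [← h]
    exact (infix_append _ _ _).sublist.countP_le

end FreeGroup

theorem stmt15 (S : Type*) [DecidableEq S] (c : S) (n : ℕ) (a b : FreeGroup S)
    (h : cExpSum c a + cExpSum c b < 2 ^ (n - 1))
    (hconj : IsConj
      ((QuotientGroup.mk a : FreeGroup S ⧸ Subgroup.normalClosure {(FreeGroup.of c) ^ (2 ^ n)}))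
      (QuotientGroup.mk b)) :
    IsConj a b := by
  obtain ⟨A, hA, haA, hcA⟩ := FreeGroup.exists_isConj_isCyclicallyReduced c a
  obtain ⟨B, hB, hbB, hcB⟩ := FreeGroup.exists_isConj_isCyclicallyReduced c b
  set π := QuotientGroup.mk' (Subgroup.normalClosure {(FreeGroup.of c) ^ (2 ^ n)})
  have hAB : IsConj (π (FreeGroup.mk A)) (π (FreeGroup.mk B)) :=
    ((π.map_isConj haA).symm.trans hconj).trans (π.map_isConj hbB)
  obtain ⟨g, hg⟩ := isConj_iff.1 hAB.symm
  obtain ⟨g, rfl⟩ := QuotientGroup.mk'_surjective _ g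
  refine (haA.trans ?_).trans hbB.symm
  refine FreeGroup.isConj_mk_of_isCyclicallyReduced (c := c) (m := 2 ^ n) (G := g.toWord)
    ?_ hA hB ?_
  · cases n with
    | zero => rw [zero_tsub, pow_zero] at h; rw [pow_zero]; lia
    | succ n => simp only [Nat.add_sub_cancel, pow_succ] at h ⊢; lia
  · rw [FreeGroup.mk_toWord, map_mul, map_mul]
    exact (mul_inv_eq_iff_eq_mul.1 hg).symm
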